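/- arXiv:2202.08116 — 15 statements merged into one kernel-verified Lean document; each statement's English description precedes it below -/
import Mathlib

section
/- G · H = I², i.e., gcd(σ(q^k), σ(n²)) · gcd(n², σ(n²)) = (gcd(n, σ(n²)))². -/
open ArithmeticFunction
open scoped ArithmeticFunction.sigma

theorem aux_mod2 (q : ℕ) (h : q % 2 = 1) (m : ℕ) :
    (∑ i ∈ Finset.range m, q ^ i) % 2 = m % 2 := by
  induction m with
  | zero => simp
  | succ m ih =>
    have h2 : q ^ m % 2 = 1 := Nat.odd_iff.mp ((Nat.odd_iff.mpr h).pow)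
    rw [Finset.sum_range_succ]
    omega

theorem aux_cop (q m : ℕ) : Nat.Coprime q (∑ i ∈ Finset.range (m + 1), q ^ i) := by
  rw [Finset.sum_range_succ']
  have : ∑ i ∈ Finset.range m, q ^ (i + 1) = q * ∑ i ∈ Finset.range m, q ^ i := by
    rw [Finset.mul_sum]
    exact Finset.sum_congr rfl (fun i _ => by ring)
  rw [this]
  simp

theorem stmt_0 (q k n : ℕ) (hq : q.Prime) (hq4 : q % 4 = 1)
    (hk : 0 < k) (hk4 : k % 4 = 1) (hn : 0 < n) (hqn : Nat.gcd q n = 1)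
    (hodd : Odd (q ^ k * n ^ 2))
    (hperf : σ 1 (q ^ k * n ^ 2) = 2 * (q ^ k * n ^ 2)) :
    Nat.gcd (σ 1 (q ^ k)) (σ 1 (n ^ 2)) * Nat.gcd (n ^ 2) (σ 1 (n ^ 2)) =
      (Nat.gcd n (σ 1 (n ^ 2))) ^ 2 := by
  have hqn' : Nat.Coprime q n := hqn
  have hcop : Nat.Coprime (q ^ k) (n ^ 2) := Nat.Coprime.pow _ _ hqn'
  rw [isMultiplicative_sigma.map_mul_of_coprime hcop] at hperf
  have hA : σ 1 (q ^ k) = ∑ i ∈ Finset.range (k + 1), q ^ i := by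
    simpa using sigma_one_apply_prime_pow (i := k) hq
  have hA2 : 2 ∣ σ 1 (q ^ k) := by
    have := aux_mod2 q (by omega) (k + 1)
    rw [hA]; omega
  have hAq : Nat.Coprime (q ^ k) (σ 1 (q ^ k)) := by
    rw [hA]; exact Nat.Coprime.pow_left _ (aux_cop q k)
  generalize σ 1 (q ^ k) = A at *
  generalize σ 1 (n ^ 2) = B at *
  obtain ⟨g, rfl⟩ := hA2
  have hB : q ^ k ∣ B := hAq.dvd_of_dvd_mul_left ⟨2 * n ^ 2, by rw [hperf]; ring⟩
  obtain ⟨h, rfl⟩ := hB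
  have hqpos : 0 < q ^ k := pow_pos hq.pos k
  have hgh : g * h = n ^ 2 := by
    apply Nat.eq_of_mul_eq_mul_left (show 0 < 2 * q ^ k by positivity)
    linarith
  have ho : Odd (q ^ k * h) := by
    rw [← hgh] at hodd
    rw [Nat.odd_mul, Nat.odd_mul] at hodd
    exact Nat.odd_mul.mpr ⟨hodd.1, hodd.2.2⟩
  have e1 : Nat.gcd (2 * g) (q ^ k * h) = Nat.gcd g h := by
    rw [Nat.Coprime.gcd_mul_left_cancel g (Nat.coprime_two_left.mpr ho)]
    exact Nat.Coprime.gcd_mul_left_cancel_right h (Nat.Coprime.coprime_dvd_right ⟨h, hgh.symm⟩ hcop)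
  have e2 : Nat.gcd (n ^ 2) (q ^ k * h) = h := by
    rw [Nat.Coprime.gcd_mul_left_cancel_right h hcop, ← hgh]
    simp
  have e3 : Nat.gcd n (q ^ k * h) = Nat.gcd n h :=
    Nat.Coprime.gcd_mul_left_cancel_right h (Nat.Coprime.pow_left _ hqn')
  rw [e1, e2, e3, ← Nat.pow_gcd_pow, ← hgh, sq h, Nat.gcd_mul_right]
end

section
/- G divides I and I divides H, i.e., gcd(σ(q^k), σ(n²)) divides gcd(n, σ(n²)), and gcd(n, σ(n²)) divides gcd(n², σ(n²)). -/
open ArithmeticFunction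
open scoped ArithmeticFunction.sigma

theorem stmt_1 (q k n : ℕ) (hq : q.Prime) (hq4 : q % 4 = 1)
    (hk : 0 < k) (hk4 : k % 4 = 1) (hn : 0 < n) (hqn : Nat.gcd q n = 1)
    (hodd : Odd (q ^ k * n ^ 2))
    (hperf : σ 1 (q ^ k * n ^ 2) = 2 * (q ^ k * n ^ 2)) :
    Nat.gcd (σ 1 (q ^ k)) (σ 1 (n ^ 2)) ∣ Nat.gcd n (σ 1 (n ^ 2)) ∧
      Nat.gcd n (σ 1 (n ^ 2)) ∣ Nat.gcd (n ^ 2) (σ 1 (n ^ 2)) := by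
  refine ⟨Nat.dvd_gcd ?_ (Nat.gcd_dvd_right _ _),
    Nat.gcd_dvd_gcd_of_dvd_left _ (dvd_pow_self n two_ne_zero)⟩
  have hcop : Nat.Coprime (q ^ k) (n ^ 2) := Nat.Coprime.pow _ _ hqn
  rw [isMultiplicative_sigma.map_mul_of_coprime hcop] at hperf
  have hq1 : Nat.Coprime (σ 1 (q ^ k)) q := by
    rw [sigma_one_apply_prime_pow hq, Finset.sum_range_succ', pow_zero]
    have h : q ∣ ∑ i ∈ Finset.range k, q ^ (i + 1) :=
      Finset.dvd_sum fun i _ => dvd_pow_self q (Nat.succ_ne_zero i)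
    obtain ⟨c, hc⟩ := h
    rw [hc]
    simp
  set G := Nat.gcd (σ 1 (q ^ k)) (σ 1 (n ^ 2)) with hG
  have h1 : G ∣ σ 1 (q ^ k) := Nat.gcd_dvd_left _ _
  have h2 : G ∣ σ 1 (n ^ 2) := Nat.gcd_dvd_right _ _
  have hGG : G ^ 2 ∣ 2 * (q ^ k * n ^ 2) := by
    rw [← hperf, sq]; exact mul_dvd_mul h1 h2
  have hG2 : Nat.Coprime G 2 := by
    rw [Nat.coprime_comm, Nat.Prime.coprime_iff_not_dvd Nat.prime_two]
    intro h
    have h4 : 2 ^ 2 ∣ 2 * (q ^ k * n ^ 2) := (pow_dvd_pow_of_dvd h 2).trans hGG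
    obtain ⟨m, hm⟩ := hodd
    rw [hm] at h4
    omega
  have hGq : Nat.Coprime G q := Nat.Coprime.coprime_dvd_left h1 hq1
  have h3 := (Nat.Coprime.pow_left 2 hG2).dvd_of_dvd_mul_left hGG
  have h5 := (Nat.Coprime.pow 2 k hGq).dvd_of_dvd_mul_left h3
  exact (Nat.pow_dvd_pow_iff two_ne_zero).1 h5
end

section
/- H / I = n / gcd(σ(q^k)/2, n); equivalently, H · gcd(σ(q^k)/2, n) = I · n, i.e., gcd(n², σ(n²)) · gcd(σ(q^k)/2, n) = gcd(n, σ(n²)) · n. -/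
open ArithmeticFunction
open scoped ArithmeticFunction.sigma

theorem aux_par (q : ℕ) (hq : q % 2 = 1) (m : ℕ) :
    (∑ j ∈ Finset.range m, q ^ j) % 2 = m % 2 := by
  induction m with
  | zero => simp
  | succ m ih =>
    have h : q ^ m % 2 = 1 := by rw [Nat.pow_mod, hq]; simp
    rw [Finset.sum_range_succ]; omega

theorem stmt_2 (q k n : ℕ) (hq : q.Prime) (hq4 : q % 4 = 1)
    (hk : 0 < k) (hk4 : k % 4 = 1) (hn : 0 < n) (hqn : Nat.gcd q n = 1)
    (hodd : Odd (q ^ k * n ^ 2))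
    (hperf : σ 1 (q ^ k * n ^ 2) = 2 * (q ^ k * n ^ 2)) :
    Nat.gcd (n ^ 2) (σ 1 (n ^ 2)) * Nat.gcd (σ 1 (q ^ k) / 2) n =
      Nat.gcd n (σ 1 (n ^ 2)) * n := by
  have hc : Nat.Coprime q n := hqn
  have hs : σ 1 (q ^ k) = ∑ j ∈ Finset.range (k + 1), q ^ j := sigma_one_apply_prime_pow hq
  have hev := aux_par q (by omega) (k + 1)
  rw [← hs] at hev
  obtain ⟨s, hs2⟩ : 2 ∣ σ 1 (q ^ k) := by omega
  have hqs : Nat.Coprime q s := by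
    rw [Nat.Prime.coprime_iff_not_dvd hq]
    intro hd
    have h1 : q ∣ ∑ j ∈ Finset.range (k + 1), q ^ j := by
      rw [← hs, hs2]; exact hd.mul_left 2
    rw [Finset.sum_range_succ'] at h1
    have h2 : q ∣ ∑ j ∈ Finset.range k, q ^ (j + 1) :=
      Finset.dvd_sum fun j _ => dvd_pow_self q (by omega)
    have h3 := (Nat.dvd_add_right h2).1 h1
    rw [pow_zero] at h3
    exact hq.one_lt.ne' (Nat.dvd_one.1 h3)
  rw [isMultiplicative_sigma.map_mul_of_coprime (hc.pow k 2), hs2] at hperf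
  have h4 : s * σ 1 (n ^ 2) = q ^ k * n ^ 2 := by
    rw [mul_assoc] at hperf
    exact Nat.eq_of_mul_eq_mul_left two_pos hperf
  obtain ⟨t, ht⟩ : q ^ k ∣ σ 1 (n ^ 2) :=
    (hqs.pow_left k).dvd_of_dvd_mul_left ⟨_, h4⟩
  rw [ht] at h4
  have hst : s * t = n ^ 2 :=
    Nat.eq_of_mul_eq_mul_left (pow_pos hq.pos k) (by rw [← h4]; ring)
  have e1 : Nat.gcd (n ^ 2) (q ^ k * t) = t := by
    rw [Nat.Coprime.gcd_mul_left_cancel_right t (hc.pow k 2)]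
    exact Nat.gcd_eq_right ⟨s, by rw [← hst, mul_comm]⟩
  have e2 : Nat.gcd n (q ^ k * t) = Nat.gcd n t :=
    Nat.Coprime.gcd_mul_left_cancel_right t (hc.pow_left k)
  have e3 : 2 * s / 2 = s := by omega
  rw [ht, hs2, e3, e1, e2, ← Nat.gcd_mul_left, ← Nat.gcd_mul_right, mul_comm t s, hst, sq]
end

section
/- I = (n / (σ(q^k)/2)) · gcd(σ(q^k)/2, n); equivalently, I · (σ(q^k)/2) = n · gcd(σ(q^k)/2, n), i.e., gcd(n, σ(n²)) · (σ(q^k)/2) = n · gcd(σ(q^k)/2, n). -/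
open ArithmeticFunction
open scoped ArithmeticFunction.sigma

theorem aux_parity (q m : ℕ) (h : q % 2 = 1) : (∑ i ∈ Finset.range m, q ^ i) % 2 = m % 2 := by
  induction m with
  | zero => simp
  | succ m ih =>
    rw [Finset.sum_range_succ]
    have : q ^ m % 2 = 1 := by
      rw [Nat.pow_mod, h]; simp
    omega

theorem stmt_3 (q k n : ℕ) (hq : q.Prime) (hq4 : q % 4 = 1)
    (hk : 0 < k) (hk4 : k % 4 = 1) (hn : 0 < n) (hqn : Nat.gcd q n = 1)
    (hodd : Odd (q ^ k * n ^ 2))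
    (hperf : σ 1 (q ^ k * n ^ 2) = 2 * (q ^ k * n ^ 2)) :
    Nat.gcd n (σ 1 (n ^ 2)) * (σ 1 (q ^ k) / 2) =
      n * Nat.gcd (σ 1 (q ^ k) / 2) n := by
  have hcop : Nat.Coprime (q ^ k) (n ^ 2) := Nat.Coprime.pow _ _ hqn
  rw [isMultiplicative_sigma.map_mul_of_coprime hcop] at hperf
  have hs : σ 1 (q ^ k) = ∑ i ∈ Finset.range (k + 1), q ^ i := by
    simp [sigma_one_apply, Nat.sum_divisors_prime_pow hq]
  have hpar := aux_parity q (k + 1) (by omega)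
  rw [← hs] at hpar
  have hc : Nat.Coprime (σ 1 (q ^ k)) q := by
    rw [hs, Finset.sum_range_succ']
    have : (∑ i ∈ Finset.range k, q ^ (i + 1)) = q * ∑ i ∈ Finset.range k, q ^ i := by
      rw [Finset.mul_sum]; exact Finset.sum_congr rfl fun i _ => by ring
    rw [this]
    simp
  obtain ⟨s, hs2⟩ : ∃ s, σ 1 (q ^ k) = 2 * s := ⟨σ 1 (q ^ k) / 2, by omega⟩
  rw [hs2] at hperf hc ⊢
  have hc' : Nat.Coprime s (q ^ k) := (Nat.Coprime.coprime_mul_left hc).pow_right k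
  have hT : s * σ 1 (n ^ 2) = q ^ k * n ^ 2 := by linarith
  rw [Nat.mul_div_cancel_left s (by norm_num), ← Nat.gcd_mul_right, mul_comm (σ 1 (n ^ 2)) s, hT,
    show q ^ k * n ^ 2 = n * (q ^ k * n) by ring, Nat.gcd_mul_left,
    Nat.Coprime.gcd_mul_left_cancel_right n hc'.symm]
end

section
/- H = I if and only if n divides σ(q^k)/2, i.e., gcd(n², σ(n²)) = gcd(n, σ(n²)) holds if and only if n divides σ(q^k)/2. -/
open ArithmeticFunction
open scoped ArithmeticFunction.sigma

theorem stmt_5 (q k n : ℕ) (hq : q.Prime) (hq4 : q % 4 = 1)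
    (hk : 0 < k) (hk4 : k % 4 = 1) (hn : 0 < n) (hqn : Nat.gcd q n = 1)
    (hodd : Odd (q ^ k * n ^ 2))
    (hperf : σ 1 (q ^ k * n ^ 2) = 2 * (q ^ k * n ^ 2)) :
    Nat.gcd (n ^ 2) (σ 1 (n ^ 2)) = Nat.gcd n (σ 1 (n ^ 2)) ↔
      n ∣ σ 1 (q ^ k) / 2 := by
  have hc : Nat.Coprime q n := hqn
  rw [isMultiplicative_sigma.map_mul_of_coprime (hc.pow k 2)] at hperf
  have hs : σ 1 (q ^ k) = ∑ i ∈ Finset.range (k + 1), q ^ i := by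
    rw [sigma_one_apply, Nat.sum_divisors_prime_pow hq]
  have heven : 2 ∣ σ 1 (q ^ k) := by
    rw [hs, Nat.dvd_iff_mod_eq_zero, Finset.sum_nat_mod]
    have h1 : ∀ i ∈ Finset.range (k + 1), q ^ i % 2 = 1 := by
      intro i _
      have : q % 2 = 1 := by omega
      rw [Nat.pow_mod, this]; simp
    rw [Finset.sum_congr rfl h1]
    simp
    omega
  have hcop : Nat.Coprime q (σ 1 (q ^ k)) := by
    rw [hq.coprime_iff_not_dvd, hs, Finset.sum_range_succ']
    intro h
    have h2 : q ∣ ∑ i ∈ Finset.range k, q ^ (i + 1) :=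
      Finset.dvd_sum fun i _ => dvd_pow_self q (Nat.succ_ne_zero i)
    have := (Nat.dvd_add_right h2).1 h
    exact hq.one_lt.ne' (by simpa using this)
  obtain ⟨t, ht⟩ := heven
  rw [ht] at hperf hcop ⊢
  have hct : Nat.Coprime q t := hcop.coprime_mul_left_right
  have e1 : t * σ 1 (n ^ 2) = q ^ k * n ^ 2 := by linarith
  have hd : q ^ k ∣ σ 1 (n ^ 2) :=
    (hct.pow_left k).dvd_of_dvd_mul_left (Dvd.intro _ e1.symm)
  obtain ⟨m, hm⟩ := hd
  rw [hm] at e1 ⊢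
  have e2 : n ^ 2 = t * m := by
    have : 0 < q ^ k := pow_pos hq.pos k
    apply Nat.eq_of_mul_eq_mul_left this
    linarith
  have hmp : 0 < m := by
    rcases Nat.eq_zero_or_pos m with h | h
    · subst h; have := pow_pos hn 2; omega
    · exact h
  have hH : Nat.gcd (n ^ 2) (q ^ k * m) = m := by
    rw [e2, Nat.gcd_mul_right, (hct.symm.pow_right k).gcd_eq_one, one_mul]
  have hI : Nat.gcd n (q ^ k * m) = Nat.gcd n m :=
    (hc.pow_left k).gcd_mul_left_cancel_right m
  rw [hH, hI, Nat.mul_div_cancel_left t two_pos, eq_comm, Nat.gcd_eq_right_iff_dvd]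
  constructor
  · rintro ⟨c, h⟩
    refine ⟨c, Nat.eq_of_mul_eq_mul_right hmp ?_⟩
    rw [← e2, pow_two]; nth_rw 2 [h]; ring
  · rintro ⟨c, h⟩
    refine ⟨c, Nat.eq_of_mul_eq_mul_left hn ?_⟩
    rw [← pow_two, e2, h]; ring
end

section
/- If H = I, then G = H = I; in particular, assuming additionally that 3 ≤ H (a result of Dris), G ≠ 1. -/
open ArithmeticFunction
open scoped ArithmeticFunction.sigma

theorem stmt_7 (q k n : ℕ) (hq : q.Prime) (hq4 : q % 4 = 1)
    (hk : 0 < k) (hk4 : k % 4 = 1) (hn : 0 < n) (hqn : Nat.gcd q n = 1)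
    (hodd : Odd (q ^ k * n ^ 2))
    (hperf : σ 1 (q ^ k * n ^ 2) = 2 * (q ^ k * n ^ 2))
    (hHI : Nat.gcd (n ^ 2) (σ 1 (n ^ 2)) = Nat.gcd n (σ 1 (n ^ 2))) :
    Nat.gcd (σ 1 (q ^ k)) (σ 1 (n ^ 2)) = Nat.gcd (n ^ 2) (σ 1 (n ^ 2)) ∧
    Nat.gcd (σ 1 (q ^ k)) (σ 1 (n ^ 2)) = Nat.gcd n (σ 1 (n ^ 2)) ∧
    (3 ≤ Nat.gcd (n ^ 2) (σ 1 (n ^ 2)) →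
      Nat.gcd (σ 1 (q ^ k)) (σ 1 (n ^ 2)) ≠ 1) := by
  have hqA : Nat.Coprime (q ^ k) (σ 1 (q ^ k)) := by
    apply Nat.Coprime.pow_left
    rw [sigma_one_apply_prime_pow hq, Finset.sum_range_succ']
    simp only [pow_succ, ← Finset.sum_mul, pow_zero]
    simp
  have hqn2 : Nat.Coprime (q ^ k) (n ^ 2) := Nat.Coprime.pow _ _ hqn
  have hAB : σ 1 (q ^ k) * σ 1 (n ^ 2) = 2 * (q ^ k * n ^ 2) := by
    rw [← hperf, isMultiplicative_sigma.map_mul_of_coprime hqn2]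
  have hA2 : 2 ∣ σ 1 (q ^ k) := by
    have hq1 : q ≡ 1 [MOD 2] := by unfold Nat.ModEq; omega
    have hs : (∑ i ∈ Finset.range (k + 1), q ^ i) ≡ ∑ i ∈ Finset.range (k + 1), 1 ^ i [MOD 2] :=
      Nat.ModEq.sum fun i _ => hq1.pow i
    rw [sigma_one_apply_prime_pow hq]
    simp [Nat.ModEq] at hs
    omega
  generalize σ 1 (q ^ k) = A at *
  generalize σ 1 (n ^ 2) = B at *
  have hdvd : q ^ k ∣ B := by
    apply hqA.dvd_of_dvd_mul_left
    rw [hAB]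
    exact ⟨2 * n ^ 2, by ring⟩
  obtain ⟨h, rfl⟩ := hdvd
  have hqpos : 0 < q ^ k := pow_pos hq.pos k
  have hAh : A * h = 2 * n ^ 2 := by
    apply Nat.eq_of_mul_eq_mul_left hqpos
    linarith
  have hhpos : 0 < h := by
    rcases Nat.eq_zero_or_pos h with rfl | h0
    · have := pow_pos hn 2
      omega
    · exact h0
  have hnodd : Odd (n ^ 2) := (Nat.odd_mul.mp hodd).2
  obtain ⟨a, rfl⟩ := hA2
  have hah : a * h = n ^ 2 := by linarith
  have hH : Nat.gcd (n ^ 2) (q ^ k * h) = h := by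
    rw [Nat.Coprime.gcd_mul_left_cancel_right _ hqn2]
    exact Nat.gcd_eq_right ⟨a, by linarith⟩
  have hhn : h ∣ n := by
    rw [hH] at hHI
    rw [hHI]
    exact Nat.gcd_dvd_left _ _
  have hG : Nat.gcd (2 * a) (q ^ k * h) = h := by
    rw [Nat.Coprime.gcd_mul_left_cancel_right _ hqA]
    apply Nat.gcd_eq_right
    obtain ⟨m, rfl⟩ := hhn
    refine ⟨2 * m ^ 2, ?_⟩
    apply Nat.eq_of_mul_eq_mul_right hhpos
    linarith
  refine ⟨by rw [hG, hH], by rw [hG, ← hHI, hH], ?_⟩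
  intro h3
  rw [hH] at h3
  rw [hG]
  omega
end

section
/- The following three conditions are equivalent: (1) H = I (i.e., gcd(n², σ(n²)) = gcd(n, σ(n²))); (2) n divides σ(q^k)/2; (3) σ(n²) divides q^k · n. -/
open ArithmeticFunction
open scoped ArithmeticFunction.sigma

theorem stmt_8 (q k n : ℕ) (hq : q.Prime) (hq4 : q % 4 = 1)
    (hk : 0 < k) (hk4 : k % 4 = 1) (hn : 0 < n) (hqn : Nat.gcd q n = 1)
    (hodd : Odd (q ^ k * n ^ 2))
    (hperf : σ 1 (q ^ k * n ^ 2) = 2 * (q ^ k * n ^ 2)) :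
    [Nat.gcd (n ^ 2) (σ 1 (n ^ 2)) = Nat.gcd n (σ 1 (n ^ 2)),
     n ∣ σ 1 (q ^ k) / 2,
     σ 1 (n ^ 2) ∣ q ^ k * n].TFAE := by
  have hqk : Nat.Coprime (q ^ k) n := Nat.Coprime.pow_left k hqn
  have hcop : Nat.Coprime (q ^ k) (n ^ 2) := Nat.Coprime.pow_right 2 hqk
  rw [isMultiplicative_sigma.map_mul_of_coprime hcop] at hperf
  have hs : σ 1 (q ^ k) = ∑ i ∈ Finset.range (k + 1), q ^ i := by
    rw [sigma_one_apply, Nat.sum_divisors_prime_pow hq]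
  have hqo : Odd q := by rw [Nat.odd_iff]; omega
  have heven : ∀ m : ℕ, Even (∑ i ∈ Finset.range (2 * m + 2), q ^ i) := by
    intro m
    induction m with
    | zero => simpa [Finset.sum_range_succ] using Odd.add_odd odd_one hqo
    | succ m ih =>
      rw [show 2 * (m + 1) + 2 = (2 * m + 2) + 1 + 1 by ring, Finset.sum_range_succ,
        Finset.sum_range_succ, add_assoc]
      exact ih.add ((hqo.pow).add_odd hqo.pow)
  have he : Even (σ 1 (q ^ k)) := by
    rw [hs]
    have := heven (k / 2)
    rwa [show 2 * (k / 2) + 2 = k + 1 by omega] at this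
  have hc : Nat.Coprime q (σ 1 (q ^ k)) := by
    rw [hs, Finset.sum_range_succ', hq.coprime_iff_not_dvd]
    intro h
    have h2 : q ∣ ∑ i ∈ Finset.range k, q ^ (i + 1) :=
      Finset.dvd_sum fun i _ => dvd_pow_self q (Nat.succ_ne_zero i)
    have h3 := (Nat.dvd_add_right h2).1 h
    exact hq.one_lt.ne' (by simpa using h3)
  obtain ⟨s, hs2⟩ := he.two_dvd
  rw [hs2] at hperf hc ⊢
  have hsq : Nat.Coprime (q ^ k) s :=
    Nat.Coprime.pow_left k (Nat.Coprime.coprime_dvd_right (Dvd.intro_left 2 rfl) hc)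
  have hp : s * σ 1 (n ^ 2) = q ^ k * n ^ 2 := by
    apply Nat.eq_of_mul_eq_mul_left (show 0 < 2 by norm_num)
    rw [← hperf]; ring
  have hsn : s ∣ n ^ 2 := hsq.symm.dvd_of_dvd_mul_left (Dvd.intro _ hp)
  obtain ⟨t, ht⟩ := hsn
  have hst : 0 < s * t := by rw [← ht]; positivity
  have hs0 : 0 < s := Nat.pos_of_mul_pos_right hst
  have ht0 : 0 < t := Nat.pos_of_mul_pos_left hst
  have hsig : σ 1 (n ^ 2) = q ^ k * t := by
    apply Nat.eq_of_mul_eq_mul_left hs0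
    rw [hp, ht]; ring
  have hqp : 0 < q ^ k := pow_pos hq.pos k
  rw [hsig, Nat.mul_div_cancel_left s (by norm_num : 0 < 2)]
  have hI : Nat.gcd n (q ^ k * t) = Nat.gcd n t := Nat.Coprime.gcd_mul_left_cancel_right t hqk
  have hH : Nat.gcd (n ^ 2) (q ^ k * t) = t := by
    rw [ht, Nat.gcd_mul_right, hsq.symm.gcd_eq_one, one_mul]
  have h1 : (Nat.gcd (n ^ 2) (q ^ k * t) = Nat.gcd n (q ^ k * t)) ↔ t ∣ n := by
    rw [hI, hH, eq_comm, Nat.gcd_eq_right_iff_dvd]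
  have h3 : q ^ k * t ∣ q ^ k * n ↔ t ∣ n := Nat.mul_dvd_mul_iff_left hqp
  have h2 : n ∣ s ↔ t ∣ n := by
    constructor
    · rintro ⟨c, rfl⟩
      refine ⟨c, Nat.eq_of_mul_eq_mul_left hn ?_⟩
      linarith
    · rintro ⟨c, hcn⟩
      refine ⟨c, Nat.eq_of_mul_eq_mul_left ht0 ?_⟩
      calc t * s = n * n := by linarith
        _ = t * (n * c) := by nth_rewrite 1 [hcn]; ring
  rw [h1, h2, h3]
  tfae_have 1 ↔ 2 := Iff.rfl
  tfae_have 2 ↔ 3 := Iff.rfl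
  tfae_finish
end

section
/- The following four conditions are equivalent: (1) σ(q^k)/2 divides n; (2) n divides σ(n²); (3) G = σ(q^k)/2; (4) I = n. -/
open ArithmeticFunction
open scoped ArithmeticFunction.sigma

theorem stmt_9 (q k n : ℕ) (hq : q.Prime) (hq4 : q % 4 = 1)
    (hk : 0 < k) (hk4 : k % 4 = 1) (hn : 0 < n) (hqn : Nat.gcd q n = 1)
    (hodd : Odd (q ^ k * n ^ 2))
    (hperf : σ 1 (q ^ k * n ^ 2) = 2 * (q ^ k * n ^ 2)) :
    [σ 1 (q ^ k) / 2 ∣ n,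
     n ∣ σ 1 (n ^ 2),
     Nat.gcd (σ 1 (q ^ k)) (σ 1 (n ^ 2)) = σ 1 (q ^ k) / 2,
     Nat.gcd n (σ 1 (n ^ 2)) = n].TFAE := by
  have hcop : Nat.Coprime (q ^ k) (n ^ 2) := Nat.Coprime.pow _ _ hqn
  rw [isMultiplicative_sigma.map_mul_of_coprime hcop] at hperf
  have hS : σ 1 (q ^ k) = ∑ i ∈ Finset.range (k + 1), q ^ i := by
    rw [sigma_one_apply_prime_pow hq]
  have heven : 2 ∣ σ 1 (q ^ k) := by
    rw [hS]
    apply Nat.dvd_of_mod_eq_zero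
    rw [Finset.sum_nat_mod]
    have h2 : q % 2 = 1 := by omega
    have : ∀ i, q ^ i % 2 = 1 := fun i => by rw [Nat.pow_mod, h2]; simp
    simp only [this, Finset.sum_const, Finset.card_range, smul_eq_mul]
    omega
  have hcs : Nat.Coprime q (σ 1 (q ^ k)) := by
    rw [Nat.Prime.coprime_iff_not_dvd hq, hS, Finset.sum_range_succ']
    intro h
    have h1 : q ∣ ∑ i ∈ Finset.range k, q ^ (i + 1) :=
      Finset.dvd_sum fun i _ => dvd_pow_self q (Nat.succ_ne_zero i)
    have h2 := (Nat.dvd_add_right h1).1 h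
    exact hq.one_lt.ne' (by simpa using h2)
  obtain ⟨s, hs⟩ := heven
  rw [hs] at hperf hcs ⊢
  generalize σ 1 (n ^ 2) = T at *
  have hsT : s * T = q ^ k * n ^ 2 := by
    apply Nat.eq_of_mul_eq_mul_left (show 0 < 2 by norm_num)
    rw [← hperf]; ring
  have hcs' : Nat.Coprime (q ^ k) s :=
    Nat.Coprime.pow_left _ (Nat.Coprime.coprime_dvd_right (Dvd.intro_left 2 rfl) hcs)
  obtain ⟨t, rfl⟩ : q ^ k ∣ T := hcs'.dvd_of_dvd_mul_left ⟨_, hsT⟩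
  have hqk : 0 < q ^ k := pow_pos hq.pos _
  have hst : s * t = n ^ 2 := by
    apply Nat.eq_of_mul_eq_mul_left hqk
    rw [← hsT]; ring
  have hTodd : Odd (q ^ k * t) := by
    rw [← hsT] at hodd
    exact (Nat.odd_mul.1 hodd).2
  have hs0 : 0 < s := by
    rcases Nat.eq_zero_or_pos s with h | h
    · rw [h, zero_mul] at hst; exact absurd hst (pow_pos hn 2).ne
    · exact h
  have hnq : Nat.Coprime n (q ^ k) := (Nat.Coprime.pow_left k hqn).symm
  have hnt : n ∣ q ^ k * t ↔ n ∣ t := hnq.dvd_mul_left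
  have hg : Nat.gcd (2 * s) (q ^ k * t) = Nat.gcd s t := by
    rw [Nat.Coprime.gcd_mul_left_cancel s (Nat.coprime_two_left.2 hTodd),
      Nat.Coprime.gcd_mul_left_cancel_right t hcs']
  rw [hg, Nat.mul_div_cancel_left s (by norm_num), Nat.gcd_eq_left_iff_dvd,
    Nat.gcd_eq_left_iff_dvd, hnt]
  tfae_have 1 → 2 := by
    rintro ⟨a, rfl⟩
    refine ⟨a, Nat.eq_of_mul_eq_mul_left hs0 ?_⟩
    rw [hst]; ring
  tfae_have 2 → 1 := by
    rintro ⟨a, rfl⟩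
    refine ⟨a, Nat.eq_of_mul_eq_mul_left hn ?_⟩
    linarith [hst, sq n, show s * (n * a) = n * (s * a) by ring]
  tfae_have 1 → 3 := by
    rintro ⟨a, rfl⟩
    refine ⟨a ^ 2, Nat.eq_of_mul_eq_mul_left hs0 ?_⟩
    rw [hst]; ring
  tfae_have 3 → 1 := by
    intro h
    rw [← Nat.pow_dvd_pow_iff (two_ne_zero), ← hst, sq]
    exact Nat.mul_dvd_mul_left s h
  tfae_have 2 ↔ 4 := Iff.rfl
  tfae_finish
end

section
/- σ(q^k)/2 divides n²; moreover, if σ(q^k)/2 is squarefree, then σ(q^k)/2 divides n. -/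
open ArithmeticFunction
open scoped ArithmeticFunction.sigma

theorem stmt_10 (q k n : ℕ) (hq : q.Prime) (hq4 : q % 4 = 1)
    (hk : 0 < k) (hk4 : k % 4 = 1) (hn : 0 < n) (hqn : Nat.gcd q n = 1)
    (hodd : Odd (q ^ k * n ^ 2))
    (hperf : σ 1 (q ^ k * n ^ 2) = 2 * (q ^ k * n ^ 2)) :
    σ 1 (q ^ k) / 2 ∣ n ^ 2 ∧
      (Squarefree (σ 1 (q ^ k) / 2) → σ 1 (q ^ k) / 2 ∣ n) := by
  have hS : σ 1 (q ^ k) = ∑ i ∈ Finset.range (k + 1), q ^ i := by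
    rw [sigma_one_apply, Nat.sum_divisors_prime_pow hq]
  have hcop : Nat.Coprime (q ^ k) (n ^ 2) := Nat.Coprime.pow k 2 hqn
  rw [isMultiplicative_sigma.map_mul_of_coprime hcop] at hperf
  have hqo : Odd q := Nat.odd_iff.mpr (by omega)
  have heven : 2 ∣ σ 1 (q ^ k) := by
    rw [hS, ← even_iff_two_dvd, Finset.even_sum_iff_even_card_odd]
    rw [Finset.filter_true_of_mem (fun i _ => hqo.pow), Finset.card_range, Nat.even_iff]
    omega
  have hSq : Nat.Coprime (σ 1 (q ^ k)) q := by
    rw [hS, Finset.sum_range_succ', Nat.coprime_comm]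
    simp only [pow_succ, ← Finset.sum_mul, pow_zero]
    simp
  obtain ⟨s, hs⟩ := heven
  have hdiv : σ 1 (q ^ k) / 2 = s := by omega
  rw [hdiv]
  have hsq : Nat.Coprime s (q ^ k) :=
    (Nat.Coprime.coprime_dvd_left ⟨2, by rw [hs, mul_comm]⟩ hSq).pow_right k
  have h1 : s ∣ n ^ 2 := by
    apply hsq.dvd_of_dvd_mul_left
    refine ⟨σ 1 (n ^ 2), ?_⟩
    rw [hs, mul_assoc] at hperf
    omega
  exact ⟨h1, fun hsf => (hsf.dvd_pow_iff_dvd two_ne_zero).mp h1⟩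
end

section
/- If σ(q^k)/2 is squarefree, then H ≠ I, i.e., gcd(n², σ(n²)) ≠ gcd(n, σ(n²)). (The proof uses the additional hypothesis that n is not squarefree, a result of Steuerwald, which may be assumed.) -/
open ArithmeticFunction
open scoped ArithmeticFunction.sigma

theorem stmt_11 (q k n : ℕ) (hq : q.Prime) (hq4 : q % 4 = 1)
    (hk : 0 < k) (hk4 : k % 4 = 1) (hn : 0 < n) (hqn : Nat.gcd q n = 1)
    (hodd : Odd (q ^ k * n ^ 2))
    (hperf : σ 1 (q ^ k * n ^ 2) = 2 * (q ^ k * n ^ 2))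
    (hsf : Squarefree (σ 1 (q ^ k) / 2)) (hnsf : ¬ Squarefree n) :
    Nat.gcd (n ^ 2) (σ 1 (n ^ 2)) ≠ Nat.gcd n (σ 1 (n ^ 2)) := by
  intro hHI
  have hcop : Nat.Coprime (q ^ k) (n ^ 2) := Nat.Coprime.pow k 2 hqn
  rw [isMultiplicative_sigma.map_mul_of_coprime hcop] at hperf
  have hB : σ 1 (q ^ k) = ∑ i ∈ Finset.range (k + 1), q ^ i := by
    rw [sigma_one_apply_prime_pow hq]
  have heven : 2 ∣ σ 1 (q ^ k) := by
    rw [hB, Nat.dvd_iff_mod_eq_zero, Finset.sum_nat_mod]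
    have : ∀ i ∈ Finset.range (k + 1), q ^ i % 2 = 1 := by
      intro i _
      have : q % 2 = 1 := by omega
      rw [Nat.pow_mod, this]; simp
    rw [Finset.sum_congr rfl this]
    simp
    omega
  have hBq : Nat.Coprime (σ 1 (q ^ k)) q := by
    rw [Nat.coprime_comm, Nat.Prime.coprime_iff_not_dvd hq, hB, Finset.sum_range_succ']
    intro h
    have h2 : q ∣ ∑ i ∈ Finset.range k, q ^ (i + 1) :=
      Finset.dvd_sum fun i _ => dvd_pow_self q (by omega)
    have := (Nat.dvd_add_right h2).1 h
    exact hq.one_lt.ne' (by simpa using this)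
  obtain ⟨A, hA⟩ := heven
  rw [hA] at hperf hsf hBq
  rw [Nat.mul_div_cancel_left A (by norm_num)] at hsf
  have hAq : Nat.Coprime A (q ^ k) := (Nat.Coprime.coprime_mul_left hBq).pow_right k
  have hAS : A * σ 1 (n ^ 2) = q ^ k * n ^ 2 := by linarith
  have hS : q ^ k ∣ σ 1 (n ^ 2) :=
    hAq.symm.dvd_of_dvd_mul_left ⟨n ^ 2, hAS⟩
  obtain ⟨m, hm⟩ := hS
  have hqk : 0 < q ^ k := pow_pos hq.pos k
  have hAm : A * m = n ^ 2 := by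
    apply Nat.eq_of_mul_eq_mul_left hqk
    rw [← hAS, hm]; ring
  have hH : Nat.gcd (n ^ 2) (σ 1 (n ^ 2)) = m := by
    rw [hm, ← hAm, Nat.gcd_mul_right, hAq.gcd_eq_one, one_mul]
  have hmn : m ∣ n := by
    rw [← hH, hHI]; exact Nat.gcd_dvd_left _ _
  obtain ⟨t, ht⟩ := hmn
  have hmpos : 0 < m := by
    rcases Nat.eq_zero_or_pos m with h | h
    · subst h; omega
    · exact h
  have hAt : A = m * (t * t) := by
    apply Nat.eq_of_mul_eq_mul_right hmpos
    rw [hAm, ht]; ring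
  have ht1 : t = 1 := by
    have := hsf t ⟨m, by rw [hAt]; ring⟩
    exact Nat.isUnit_iff.1 this
  subst ht1
  apply hnsf
  rw [ht]
  simpa [hAt] using hsf
end

section
/- If H = gcd(n², σ(n²)) is squarefree, then σ(q^k)/2 is not squarefree. (The proof uses the additional hypothesis that n is not squarefree, a result of Steuerwald, which may be assumed.) -/
open ArithmeticFunction
open scoped ArithmeticFunction.sigma

theorem stmt_13 (q k n : ℕ) (hq : q.Prime) (hq4 : q % 4 = 1)
    (hk : 0 < k) (hk4 : k % 4 = 1) (hn : 0 < n) (hqn : Nat.gcd q n = 1)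
    (hodd : Odd (q ^ k * n ^ 2))
    (hperf : σ 1 (q ^ k * n ^ 2) = 2 * (q ^ k * n ^ 2))
    (hsf : Squarefree (Nat.gcd (n ^ 2) (σ 1 (n ^ 2)))) (hnsf : ¬ Squarefree n) :
    ¬ Squarefree (σ 1 (q ^ k) / 2) := by
  intro hs
  have hcop : Nat.Coprime (q ^ k) (n ^ 2) := Nat.Coprime.pow k 2 hqn
  rw [isMultiplicative_sigma.map_mul_of_coprime hcop] at hperf
  have heven : σ 1 (q ^ k) % 2 = 0 := by
    rw [sigma_one_apply_prime_pow hq]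
    have h : ∀ j, (∑ i ∈ Finset.range j, q ^ i) % 2 = j % 2 := by
      intro j
      induction j with
      | zero => simp
      | succ j ih =>
        have h1 : q ^ j % 2 = 1 := by
          rw [Nat.pow_mod, show q % 2 = 1 by omega]; simp
        rw [Finset.sum_range_succ]
        omega
    rw [h]; omega
  obtain ⟨s, hss⟩ := Nat.dvd_of_mod_eq_zero heven
  rw [hss] at hperf hs
  rw [Nat.mul_div_cancel_left s (by norm_num)] at hs
  have hmain : s * σ 1 (n ^ 2) = q ^ k * n ^ 2 := by
    apply Nat.eq_of_mul_eq_mul_left (show 0 < 2 by norm_num)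
    rw [← hperf]; ring
  generalize σ 1 (n ^ 2) = m at *
  rw [Nat.squarefree_iff_prime_squarefree] at hnsf hs hsf
  push Not at hnsf
  obtain ⟨p, hp, hpn⟩ := hnsf
  have h4 : p ^ 4 ∣ n ^ 2 := by
    have := pow_dvd_pow_of_dvd hpn 2
    rwa [show (p * p) ^ 2 = p ^ 4 by ring] at this
  have h4' : p ^ 4 ∣ s * m := hmain ▸ Dvd.dvd.mul_left h4 _
  have h3 : p ^ 3 ∣ m := by
    by_cases hps : p ∣ s
    · obtain ⟨t, rfl⟩ := hps
      have hpt : ¬ p ∣ t := fun h => hs p hp (Nat.mul_dvd_mul_left p h)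
      have h5 : p * p ^ 3 ∣ p * (t * m) := by
        convert h4' using 1 <;> ring
      have h6 := Nat.dvd_of_mul_dvd_mul_left hp.pos h5
      exact (Nat.Coprime.pow_left 3 ((Nat.Prime.coprime_iff_not_dvd hp).2 hpt)).dvd_of_dvd_mul_left h6
    · exact (Nat.Coprime.pow_left 3 ((Nat.Prime.coprime_iff_not_dvd hp).2 hps)).dvd_of_dvd_mul_left
        ((pow_dvd_pow p (by norm_num)).trans h4')
  apply hsf p hp
  rw [← pow_two]
  exact Nat.dvd_gcd ((pow_dvd_pow p (by norm_num)).trans h4) ((pow_dvd_pow p (by norm_num)).trans h3)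
end

section
/- For every positive integer m such that 3 divides m exactly twice (ν₃(m) = 2) and 11 divides m exactly once (ν₁₁(m) = 1), one has gcd(m, σ(m²)) ≠ gcd(m², σ(m²)). -/
open ArithmeticFunction
open scoped ArithmeticFunction.sigma

theorem stmt_14 (m : ℕ) (hm : 0 < m)
    (h3 : m.factorization 3 = 2) (h11 : m.factorization 11 = 1) :
    Nat.gcd m (σ 1 (m ^ 2)) ≠ Nat.gcd (m ^ 2) (σ 1 (m ^ 2)) := by
  intro h
  have p3 : Nat.Prime 3 := by norm_num
  have p11 : Nat.Prime 11 := by norm_num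
  obtain ⟨k, hk⟩ : 3 ^ 2 ∣ m := (p3.pow_dvd_iff_le_factorization hm.ne').2 h3.ge
  have hk3 : ¬ 3 ∣ k := by
    intro hd
    have h27 : 3 ^ 3 ∣ m := by
      obtain ⟨j, rfl⟩ := hd
      exact ⟨j, by rw [hk]; ring⟩
    have := (p3.pow_dvd_iff_le_factorization hm.ne').1 h27
    omega
  have hcop : Nat.Coprime (3 ^ 4) (k ^ 2) :=
    Nat.Coprime.pow 4 2 ((Nat.Prime.coprime_iff_not_dvd p3).2 hk3)
  have hs : σ 1 (3 ^ 4) = 121 := by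
    rw [sigma_one_apply_prime_pow p3]; decide
  have h1 : 121 ∣ σ 1 (m ^ 2) := by
    have e : m ^ 2 = 3 ^ 4 * k ^ 2 := by rw [hk]; ring
    rw [e, isMultiplicative_sigma.map_mul_of_coprime hcop, hs]
    exact dvd_mul_right _ _
  have hd : 11 ^ 1 ∣ m := (p11.pow_dvd_iff_le_factorization hm.ne').2 h11.ge
  have h2 : 121 ∣ m ^ 2 := by
    have := pow_dvd_pow_of_dvd hd 2
    norm_num at this
    exact this
  have h4 : 11 ^ 2 ∣ m := by
    have := Nat.dvd_gcd h2 h1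
    rw [← h] at this
    exact (by norm_num : (11 ^ 2 : ℕ) = 121) ▸ this.trans (Nat.gcd_dvd_left _ _)
  have := (p11.pow_dvd_iff_le_factorization hm.ne').1 h4
  omega
end

section
/- The upper asymptotic density of the set A = {m ∈ ℤ⁺ : gcd(m, σ(m²)) = gcd(m², σ(m²))} is strictly less than 1; in particular, limsup_{N→∞} #{m ≤ N : gcd(m, σ(m²)) = gcd(m², σ(m²))}/N ≤ 3247/3267. -/
open ArithmeticFunction
open scoped ArithmeticFunction.sigma

lemma aux_bad (m : ℕ) (h : Nat.gcd m 3267 = 99) :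
    Nat.gcd m (σ 1 (m ^ 2)) ≠ Nat.gcd (m ^ 2) (σ 1 (m ^ 2)) := by
  intro he
  have h99 : 99 ∣ m := h ▸ Nat.gcd_dvd_left m 3267
  have h121 : ¬ 121 ∣ m := by
    intro h1
    have := Nat.dvd_gcd h1 (by norm_num : 121 ∣ 3267)
    rw [h] at this
    revert this; norm_num
  have h27 : ¬ 27 ∣ m := by
    intro h1
    have := Nat.dvd_gcd h1 (by norm_num : 27 ∣ 3267)
    rw [h] at this
    revert this; norm_num
  obtain ⟨k, rfl⟩ := h99
  have hc : Nat.Coprime (3 ^ 4) ((11 * k) ^ 2) := by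
    apply Nat.Coprime.pow
    rw [Nat.Prime.coprime_iff_not_dvd Nat.prime_three]
    omega
  have hs : σ 1 ((99 * k) ^ 2) = 121 * σ 1 ((11 * k) ^ 2) := by
    have : (99 * k) ^ 2 = 3 ^ 4 * (11 * k) ^ 2 := by ring
    rw [this, isMultiplicative_sigma.map_mul_of_coprime hc,
      sigma_one_apply_prime_pow Nat.prime_three]
    norm_num [Finset.sum_range_succ]
  have h1 : 121 ∣ Nat.gcd ((99 * k) ^ 2) (σ 1 ((99 * k) ^ 2)) := by
    apply Nat.dvd_gcd
    · exact ⟨81 * k ^ 2, by ring⟩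
    · rw [hs]; exact dvd_mul_right _ _
  rw [← he] at h1
  exact h121 (h1.trans (Nat.gcd_dvd_left _ _))

lemma aux_per : Function.Periodic (fun m : ℕ => ¬ Nat.gcd m 3267 = 99) 3267 := by
  intro m
  simp

set_option maxRecDepth 100000 in
lemma aux_count : Nat.count (fun m : ℕ => ¬ Nat.gcd m 3267 = 99) 3267 = 3247 := by
  decide +kernel

lemma aux_blocks (q : ℕ) :
    ((Finset.Ico 1 (1 + 3267 * q)).filter (fun m : ℕ => ¬ Nat.gcd m 3267 = 99)).card
      ≤ 3247 * q := by
  induction q with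
  | zero => simp
  | succ q ih =>
    have h := Nat.filter_Ico_card_eq_of_periodic (1 + 3267 * q) 3267 _ aux_per
    rw [aux_count] at h
    have hu : Finset.Ico 1 (1 + 3267 * (q + 1)) =
        Finset.Ico 1 (1 + 3267 * q) ∪ Finset.Ico (1 + 3267 * q) (1 + 3267 * q + 3267) := by
      have e : 1 + 3267 * (q + 1) = 1 + 3267 * q + 3267 := by ring
      rw [Finset.Ico_union_Ico_eq_Ico (by omega) (by omega), e]
    rw [hu, Finset.filter_union]
    refine (Finset.card_union_le _ _).trans ?_
    rw [h]
    omega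

lemma aux_bound (N : ℕ) :
    (((Finset.Icc 1 N).filter
      (fun m => Nat.gcd m (σ 1 (m ^ 2)) = Nat.gcd (m ^ 2) (σ 1 (m ^ 2)))).card : ℝ)
      ≤ 3247 / 3267 * N + 3247 := by
  have h1 : ((Finset.Icc 1 N).filter
      (fun m => Nat.gcd m (σ 1 (m ^ 2)) = Nat.gcd (m ^ 2) (σ 1 (m ^ 2)))).card
      ≤ 3247 * (N / 3267 + 1) := by
    refine le_trans (Finset.card_le_card ?_) (aux_blocks (N / 3267 + 1))
    intro m hm
    simp only [Finset.mem_filter, Finset.mem_Icc, Finset.mem_Ico] at hm ⊢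
    refine ⟨⟨hm.1.1, by omega⟩, fun h => aux_bad m h hm.2⟩
  have h2 : ((N / 3267 : ℕ) : ℝ) ≤ N / 3267 := by
    exact_mod_cast Nat.cast_div_le (α := ℝ) (m := N) (n := 3267)
  have h3 := (Nat.cast_le (α := ℝ)).2 h1
  push_cast at h3
  linarith

theorem stmt_15 :
    Filter.limsup
      (fun N : ℕ =>
        (((Finset.Icc 1 N).filter
            (fun m => Nat.gcd m (σ 1 (m ^ 2)) = Nat.gcd (m ^ 2) (σ 1 (m ^ 2)))).card : ℝ) / N)
      Filter.atTop ≤ 3247 / 3267 := by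
  have ht : Filter.Tendsto (fun N : ℕ => (3247 / 3267 : ℝ) + 3247 / (N : ℝ)) Filter.atTop
      (nhds (3247 / 3267)) := by
    simpa using (tendsto_const_div_atTop_nhds_zero_nat (3247 : ℝ)).const_add (3247 / 3267 : ℝ)
  rw [← ht.limsup_eq]
  refine Filter.limsup_le_limsup ?_ ?_ ht.isBoundedUnder_le
  · filter_upwards [Filter.eventually_gt_atTop 0] with N hN
    have hN' : (0 : ℝ) < N := by exact_mod_cast hN
    rw [div_le_iff₀ hN']
    have := aux_bound N
    have e : (3247 / 3267 + 3247 / (N : ℝ)) * N = 3247 / 3267 * N + 3247 := by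
      field_simp
    rw [e]; exact this
  · apply Filter.IsBoundedUnder.isCoboundedUnder_le
    exact Filter.isBoundedUnder_of ⟨0, fun N => by positivity⟩
end

section
/- K ≠ 1, where K = gcd(n, σ(q^k)/2); that is, gcd(n, σ(q^k)/2) > 1. -/
open ArithmeticFunction
open scoped ArithmeticFunction.sigma

theorem even_geom_aux (q : ℕ) (hq : q % 2 = 1) (m : ℕ) :
    2 ∣ ∑ i ∈ Finset.range (2 * m), q ^ i := by
  induction m with
  | zero => simp
  | succ m ih =>
    rw [show 2 * (m + 1) = 2 * m + 1 + 1 by ring, Finset.sum_range_succ, Finset.sum_range_succ]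
    have h1 : q ^ (2 * m) % 2 = 1 := Nat.odd_iff.mp ((Nat.odd_iff.mpr hq).pow)
    have h2 : q ^ (2 * m + 1) % 2 = 1 := Nat.odd_iff.mp ((Nat.odd_iff.mpr hq).pow)
    omega

theorem stmt_16 (q k n : ℕ) (hq : q.Prime) (hq4 : q % 4 = 1)
    (hk : 0 < k) (hk4 : k % 4 = 1) (hn : 0 < n) (hqn : Nat.gcd q n = 1)
    (hodd : Odd (q ^ k * n ^ 2))
    (hperf : σ 1 (q ^ k * n ^ 2) = 2 * (q ^ k * n ^ 2)) :
    1 < Nat.gcd n (σ 1 (q ^ k) / 2) := by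
  have hcop : Nat.Coprime (q ^ k) (n ^ 2) := Nat.Coprime.pow _ _ hqn
  rw [isMultiplicative_sigma.map_mul_of_coprime hcop] at hperf
  have hs : σ 1 (q ^ k) = ∑ i ∈ Finset.range (k + 1), q ^ i := by
    rw [sigma_one_apply_prime_pow hq]
  have heven : 2 ∣ σ 1 (q ^ k) := by
    rw [hs, show k + 1 = 2 * ((k + 1) / 2) by omega]
    exact even_geom_aux q (by omega) _
  have hsq : Nat.Coprime (σ 1 (q ^ k)) q := by
    rw [hs, Finset.sum_range_succ', Nat.coprime_comm, hq.coprime_iff_not_dvd]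
    intro h
    have h3 : q ∣ ∑ i ∈ Finset.range k, q ^ (i + 1) :=
      Finset.dvd_sum fun i _ => dvd_pow_self q (by omega)
    have := (Nat.dvd_add_right h3).mp h
    simp at this
    exact hq.one_lt.ne' this
  have hbig : 4 ≤ σ 1 (q ^ k) := by
    rw [hs, Finset.sum_range_succ]
    have : q ≤ q ^ k := Nat.le_self_pow hk.ne' q
    have := hq.two_le
    omega
  obtain ⟨t, ht⟩ := heven
  rw [ht] at hperf hsq hbig ⊢
  rw [Nat.mul_div_cancel_left t (by norm_num)]
  have htq : Nat.Coprime t (q ^ k) := (Nat.Coprime.coprime_mul_left hsq).pow_right k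
  have hd : t ∣ q ^ k * n ^ 2 := ⟨σ 1 (n ^ 2), by nlinarith⟩
  have hd2 : t ∣ n ^ 2 := htq.dvd_of_dvd_mul_left hd
  have hpos : 0 < Nat.gcd n t := Nat.gcd_pos_of_pos_left _ hn
  by_contra hcon
  have h1 : Nat.Coprime n t := by unfold Nat.Coprime; omega
  have : t = 1 := Nat.Coprime.eq_one_of_dvd ((h1.symm).pow_right 2) hd2
  omega
end

section
/- gcd(n, σ(q^k)/2) ≥ 3. -/
open ArithmeticFunction
open scoped ArithmeticFunction.sigma

theorem stmt_17 (q k n : ℕ) (hq : q.Prime) (hq4 : q % 4 = 1)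
    (hk : 0 < k) (hk4 : k % 4 = 1) (hn : 0 < n) (hqn : Nat.gcd q n = 1)
    (hodd : Odd (q ^ k * n ^ 2))
    (hperf : σ 1 (q ^ k * n ^ 2) = 2 * (q ^ k * n ^ 2)) :
    3 ≤ Nat.gcd n (σ 1 (q ^ k) / 2) := by
  have hcop : Nat.Coprime (q ^ k) (n ^ 2) := Nat.Coprime.pow _ _ hqn
  rw [isMultiplicative_sigma.map_mul_of_coprime hcop] at hperf
  have hs : σ 1 (q ^ k) = ∑ i ∈ Finset.range (k + 1), q ^ i := by
    rw [sigma_one_apply_prime_pow hq]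
  have hq5 : 5 ≤ q := by
    have := hq.two_le
    omega
  have heven : ∀ m : ℕ, 2 ∣ ∑ i ∈ Finset.range (2 * m), q ^ i := by
    intro m
    induction m with
    | zero => simp
    | succ m ih =>
      rw [show 2 * (m + 1) = 2 * m + 1 + 1 by ring, Finset.sum_range_succ, Finset.sum_range_succ,
        add_assoc]
      refine dvd_add ih ?_
      have h1 : q ^ (2 * m) + q ^ (2 * m + 1) = q ^ (2 * m) * (q + 1) := by ring
      rw [h1]
      exact Dvd.dvd.mul_left (by omega) _
  have h2 : 2 ∣ σ 1 (q ^ k) := by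
    rw [hs, show k + 1 = 2 * ((k + 1) / 2) by omega]
    exact heven _
  have hform : σ 1 (q ^ k) = q * (∑ i ∈ Finset.range k, q ^ i) + 1 := by
    rw [hs, Finset.sum_range_succ', Finset.mul_sum]
    simp [pow_succ, mul_comm]
  have hge : 1 ≤ ∑ i ∈ Finset.range k, q ^ i := by
    have := Finset.single_le_sum (f := fun i => q ^ i) (fun i _ => Nat.zero_le _)
      (Finset.mem_range.mpr hk)
    simpa using this
  obtain ⟨t, ht⟩ := h2
  have htd : σ 1 (q ^ k) / 2 = t := by omega
  have ht1 : t ≠ 1 := by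
    intro h
    nlinarith
  rw [htd]
  have hmul : t * σ 1 (n ^ 2) = q ^ k * n ^ 2 := by
    rw [ht] at hperf
    nlinarith
  obtain ⟨p, hp, hpt⟩ := Nat.exists_prime_and_dvd ht1
  have hpd : p ∣ q ^ k * n ^ 2 := hmul ▸ Dvd.dvd.mul_right hpt _
  have hpn : p ∣ n := by
    rcases hp.dvd_mul.mp hpd with h | h
    · have h' := (Nat.prime_dvd_prime_iff_eq hp hq).mp (hp.dvd_of_dvd_pow h)
      subst h'
      exfalso
      have h3 : p ∣ p * (∑ i ∈ Finset.range k, p ^ i) + 1 := by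
        rw [← hform, ht]
        exact Dvd.dvd.mul_left hpt _
      exact hp.one_lt.ne' (Nat.dvd_one.mp ((Nat.dvd_add_right (dvd_mul_right _ _)).mp h3))
    · exact hp.dvd_of_dvd_pow h
  have hp2 : p ≠ 2 := by
    rintro rfl
    exact (Nat.not_even_iff_odd.mpr hodd) (even_iff_two_dvd.mpr hpd)
  have hle := Nat.le_of_dvd (Nat.gcd_pos_of_pos_left t hn) (Nat.dvd_gcd hpn hpt)
  have := hp.two_le
  omega
end
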